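/- arXiv:2504.01696 — 3 statements merged into one kernel-verified Lean document; each statement's English description precedes it below -/
import Mathlib

section
/- Let p be a prime, r ≥ 1 an integer, G a cyclic group of order p^r with generator γ, and R = F_p[G]. Every cyclic R-module M (i.e., a module generated by a single element) is isomorphic as an R-module to the ideal ((γ − 1)^t) of R for some integer 0 ≤ t ≤ p^r. -/
open Polynomial in
/-- If a nilpotent element `a` generates `A` as an algebra over a field, then every ideal of `A`
is generated by a power of `a`. -/
theorem Ideal.exists_eq_span_pow_of_aeval_surjective {K A : Type*} [Field K] [CommRing A]
    [Algebra K A] {a : A} (ha : Function.Surjective (aeval (R := K) a)) {n : ℕ}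
    (hn : a ^ n = 0) (I : Ideal A) : ∃ s ≤ n, I = Ideal.span {a ^ s} := by
  obtain ⟨f, hf⟩ := (IsPrincipalIdealRing.principal (I.comap (aeval (R := K) a))).principal
  rw [Ideal.submodule_span_eq] at hf
  have hX : (X : K[X]) ^ n ∈ Ideal.span {f} := by
    rw [← hf, Ideal.mem_comap]
    simp [hn]
  obtain ⟨s, hs, hfs⟩ := (dvd_prime_pow prime_X n).1 (Ideal.mem_span_singleton.1 hX)
  refine ⟨s, hs, ?_⟩
  rw [← Ideal.map_comap_of_surjective _ ha I, hf, Ideal.span_singleton_eq_span_singleton.2 hfs,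
    Ideal.map_span, Set.image_singleton, map_pow, aeval_X]

open Polynomial in
/-- If `a` generates `A` as an algebra over a field and has nilpotency index exactly `n`, then the
annihilator of `a ^ (n - s)` is generated by `a ^ s`. -/
theorem Ideal.torsionOf_pow_sub_of_aeval_surjective {K A : Type*} [Field K] [CommRing A]
    [Algebra K A] {a : A} (ha : Function.Surjective (aeval (R := K) a)) {n : ℕ}
    (hn : a ^ n = 0) (hmin : ∀ m, a ^ m = 0 → n ≤ m) {s : ℕ} (hs : s ≤ n) :
    Ideal.torsionOf A A (a ^ (n - s)) = Ideal.span {a ^ s} := by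
  apply le_antisymm
  · obtain ⟨u, -, hu⟩ := Ideal.exists_eq_span_pow_of_aeval_surjective ha hn
      (Ideal.torsionOf A A (a ^ (n - s)))
    have h : a ^ u ∈ Ideal.torsionOf A A (a ^ (n - s)) := hu ▸ Ideal.mem_span_singleton_self _
    rw [Ideal.mem_torsionOf_iff, smul_eq_mul, ← pow_add] at h
    have := hmin _ h
    rw [hu, Ideal.span_singleton_le_span_singleton]
    exact pow_dvd_pow a (by omega)
  · rw [Ideal.span_singleton_le_iff_mem, Ideal.mem_torsionOf_iff, smul_eq_mul, ← pow_add,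
      Nat.add_sub_cancel' hs, hn]

open Polynomial in
theorem MonoidAlgebra.aeval_of_sub_one_surjective (K : Type*) [Field K] {G : Type*} [CommGroup G]
    [Finite G] {g : G} (hg : ∀ x : G, x ∈ Subgroup.zpowers g) :
    Function.Surjective (aeval (R := K) (MonoidAlgebra.of K G g - 1)) := by
  rw [← AlgHom.range_eq_top, eq_top_iff]
  rintro y -
  induction y using MonoidAlgebra.induction_on with
  | of x =>
    obtain ⟨k, rfl⟩ := mem_powers_iff_mem_zpowers.2 (hg x)
    exact ⟨(X + 1) ^ k, by simp⟩
  | add y z hy hz => exact add_mem hy hz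
  | smul c y hy => exact Subalgebra.smul_mem _ hy c

open Polynomial in
theorem MonoidAlgebra.orderOf_le_of_of_sub_one_pow_eq_zero {K : Type*} [Field K] {G : Type*}
    [CommGroup G] {g : G} {m : ℕ} (h : (MonoidAlgebra.of K G g - 1) ^ m = 0) :
    orderOf g ≤ m := by
  by_contra! hm
  have hdeg : ((X - C 1 : K[X]) ^ m).natDegree = m := by
    rw [natDegree_pow, natDegree_X_sub_C, mul_one]
  have h0 : aeval (MonoidAlgebra.of K G g) ((X - C 1 : K[X]) ^ m) = 0 := by simpa using h
  rw [aeval_eq_sum_range, hdeg, Finset.sum_range_succ] at h0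
  have hc : ((X - C 1 : K[X]) ^ m).coeff m = 1 := by
    have := ((monic_X_sub_C (1 : K)).pow m).coeff_natDegree
    rwa [hdeg] at this
  rw [hc] at h0
  have h1 := congrArg (fun y : MonoidAlgebra K G => y.coeff (g ^ m)) h0
  have hz : ∀ i ∈ Finset.range m,
      (Finsupp.single (g ^ i) (((X - 1 : K[X]) ^ m).coeff i)) (g ^ m) = 0 := by
    intro i hi
    have him := Finset.mem_range.1 hi
    exact Finsupp.single_eq_of_ne' fun e => him.ne (pow_injOn_Iio_orderOf (him.trans hm) hm e)
  simp [MonoidAlgebra.single_pow, Finset.sum_eq_zero hz] at h1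

theorem MonoidAlgebra.of_sub_one_pow_char_pow {p r : ℕ} [Fact p.Prime] {K : Type*} [Field K]
    [CharP K p] {G : Type*} [CommGroup G] {g : G} (hg : g ^ p ^ r = 1) :
    (MonoidAlgebra.of K G g - 1) ^ p ^ r = 0 := by
  have : CharP (MonoidAlgebra K G) p := charP_of_injective_algebraMap' K p
  rw [sub_pow_char_pow, ← map_pow, hg, map_one, one_pow, sub_self]

theorem cyclic_module_iso_span_pow_gen_sub_one (p r : ℕ) [Fact p.Prime] (hr : 1 ≤ r)
    {G : Type*} [CommGroup G] [Fintype G] (γ : G)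
    (hcard : Fintype.card G = p ^ r)
    (hγ : ∀ x : G, x ∈ Subgroup.zpowers γ)
    {M : Type*} [AddCommGroup M] [Module (MonoidAlgebra (ZMod p) G) M]
    (x : M) (hx : Submodule.span (MonoidAlgebra (ZMod p) G) {x} = ⊤) :
    ∃ t ≤ p ^ r, Nonempty
      (M ≃ₗ[MonoidAlgebra (ZMod p) G]
        (Ideal.span {(MonoidAlgebra.of (ZMod p) G γ - 1) ^ t} :
          Ideal (MonoidAlgebra (ZMod p) G))) := by
  have hsurj := MonoidAlgebra.aeval_of_sub_one_surjective (ZMod p) hγ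
  have hord : orderOf γ = p ^ r := by
    rw [orderOf_eq_card_of_forall_mem_zpowers hγ, Nat.card_eq_fintype_card, hcard]
  have hnil := MonoidAlgebra.of_sub_one_pow_char_pow (K := ZMod p) (hord ▸ pow_orderOf_eq_one γ)
  have hmin (m : ℕ) (h : (MonoidAlgebra.of (ZMod p) G γ - 1) ^ m = 0) : p ^ r ≤ m :=
    hord ▸ MonoidAlgebra.orderOf_le_of_of_sub_one_pow_eq_zero h
  obtain ⟨s, hs, hI⟩ := Ideal.exists_eq_span_pow_of_aeval_surjective hsurj hnil
    (Ideal.torsionOf (MonoidAlgebra (ZMod p) G) M x)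
  have htors := hI.trans (Ideal.torsionOf_pow_sub_of_aeval_surjective hsurj hnil hmin hs).symm
  exact ⟨p ^ r - s, Nat.sub_le _ _, ⟨(LinearEquiv.ofTop _ hx).symm ≪≫ₗ
    (Ideal.quotTorsionOfEquivSpanSingleton _ M x).symm ≪≫ₗ
    Submodule.quotEquivOfEq _ _ htors ≪≫ₗ
    Ideal.quotTorsionOfEquivSpanSingleton _ _ _⟩⟩
end

section
/- Let p be a prime, m ≥ 0 an integer, G a cyclic group of order p^{m+1} with generator γ, and R = F_p[G]. Then the set of elements of R fixed by multiplication by γ^{p^m}, namely {x ∈ R : γ^{p^m}·x = x}, is exactly the ideal ((γ − 1)^{p^{m+1} − p^m}) of R generated by (γ − 1)^{p^{m+1} − p^m}. -/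
open Polynomial in
theorem Algebra.minpoly_eq_X_pow_finrank_of_adjoin_eq_top {K A : Type*} [Field K] [CommRing A]
    [Algebra K A] [Module.Finite K A] {t : A} (ht : Algebra.adjoin K {t} = ⊤)
    (hpow : t ^ Module.finrank K A = 0) : minpoly K t = X ^ Module.finrank K A := by
  have hint : IsIntegral K t := Algebra.IsIntegral.isIntegral t
  have hdeg : (minpoly K t).natDegree = Module.finrank K A := by
    rw [← Algebra.adjoin.powerBasis_dim hint, ← PowerBasis.finrank, ht]
    exact Subalgebra.topEquiv.toLinearEquiv.finrank_eq
  exact (eq_of_monic_of_dvd_of_natDegree_le (minpoly.monic hint) (monic_X_pow _)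
    (minpoly.dvd K t (by simpa using hpow)) (by simp [hdeg])).symm

open Polynomial in
theorem Algebra.pow_mul_eq_zero_iff_of_adjoin_eq_top {K A : Type*} [Field K] [CommRing A]
    [Algebra K A] [Module.Finite K A] {t : A} (ht : Algebra.adjoin K {t} = ⊤)
    (hpow : t ^ Module.finrank K A = 0) {q : ℕ} (hq : q ≤ Module.finrank K A) (x : A) :
    t ^ q * x = 0 ↔ t ^ (Module.finrank K A - q) ∣ x := by
  constructor
  · intro hx
    obtain ⟨f, rfl⟩ : ∃ f : K[X], aeval t f = x := by
      have hmem : x ∈ Algebra.adjoin K {t} := ht ▸ Algebra.mem_top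
      rwa [Algebra.adjoin_singleton_eq_range_aeval] at hmem
    have hdvd : minpoly K t ∣ X ^ q * f := minpoly.dvd K t (by simpa using hx)
    rw [Algebra.minpoly_eq_X_pow_finrank_of_adjoin_eq_top ht hpow,
      ← Nat.add_sub_cancel' hq, pow_add,
      mul_dvd_mul_iff_left (pow_ne_zero _ X_ne_zero)] at hdvd
    simpa using map_dvd (aeval t) hdvd
  · rintro ⟨y, rfl⟩
    rw [← mul_assoc, ← pow_add, Nat.add_sub_cancel' hq, hpow, zero_mul]

theorem MonoidAlgebra.adjoin_of_sub_one_eq_top (K : Type*) [CommRing K] {G : Type*} [CommGroup G]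
    [Finite G] {γ : G} (hγ : ∀ x : G, x ∈ Subgroup.zpowers γ) :
    Algebra.adjoin K {MonoidAlgebra.of K G γ - 1} = ⊤ := by
  have hmem : MonoidAlgebra.of K G γ ∈ Algebra.adjoin K {MonoidAlgebra.of K G γ - 1} := by
    simpa using add_mem (Algebra.self_mem_adjoin_singleton K (MonoidAlgebra.of K G γ - 1))
      (one_mem _)
  refine eq_top_iff.2 fun x _ => ?_
  induction x using MonoidAlgebra.induction_on with
  | of g =>
    obtain ⟨n, rfl⟩ := mem_powers_iff_mem_zpowers.2 (hγ g)
    simpa only [map_pow] using pow_mem hmem n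
  | add a b ha hb => exact add_mem (ha trivial) (hb trivial)
  | smul r a ha => exact Subalgebra.smul_mem _ (ha trivial) r

theorem fixed_points_eq_span_pow_gen_sub_one (p : ℕ) [Fact p.Prime] (m : ℕ)
    {G : Type*} [CommGroup G] [Fintype G] (γ : G)
    (hcard : Fintype.card G = p ^ (m + 1))
    (hγ : ∀ x : G, x ∈ Subgroup.zpowers γ) :
    {x : MonoidAlgebra (ZMod p) G | (MonoidAlgebra.of (ZMod p) G γ) ^ (p ^ m) * x = x} =
      (Ideal.span {(MonoidAlgebra.of (ZMod p) G γ - 1) ^ (p ^ (m + 1) - p ^ m)} :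
        Ideal (MonoidAlgebra (ZMod p) G)) := by
  have : CharP (MonoidAlgebra (ZMod p) G) p := charP_of_injective_algebraMap' (ZMod p) p
  have hrank : Module.finrank (ZMod p) (MonoidAlgebra (ZMod p) G) = p ^ (m + 1) := by
    rw [← hcard]
    exact Module.finrank_eq_card_basis (MonoidAlgebra.basis G (ZMod p))
  have hpow : (MonoidAlgebra.of (ZMod p) G γ - 1) ^ p ^ (m + 1) = 0 := by
    rw [sub_pow_char_pow, ← map_pow, ← hcard, pow_card_eq_one, map_one, one_pow, sub_self]
  ext x
  have key := Algebra.pow_mul_eq_zero_iff_of_adjoin_eq_top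
    (MonoidAlgebra.adjoin_of_sub_one_eq_top (ZMod p) hγ) (hrank ▸ hpow)
    (q := p ^ m) (hrank ▸ Nat.pow_le_pow_right (Fact.out : p.Prime).pos m.le_succ) x
  rw [hrank, sub_pow_char_pow, one_pow, sub_mul, one_mul, sub_eq_zero] at key
  rw [Set.mem_ofPred_eq, SetLike.mem_coe, Ideal.mem_span_singleton, key]
end

section
/- Let p be a prime and S a finitely generated free module over the ring ℤ_p of p-adic integers. Let (N_m)_{m≥0} be a decreasing sequence of ℤ_p-submodules of S (N_{m+1} ⊆ N_m for all m), and suppose that for each m there exists v_m ∈ N_m with v_m ∉ pS. Then there exists an element v ∈ ⋂_{m≥0} N_m with v ∉ pS. -/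
theorem PadicInt.isOpen_setOf_dvd (p : ℕ) [Fact p.Prime] :
    IsOpen {x : PadicInt p | (p : PadicInt p) ∣ x} := by
  simp_rw [← PadicInt.norm_lt_one_iff_dvd]
  exact isOpen_lt continuous_norm continuous_const

theorem PadicInt.isOpen_setOf_exists_eq_smul (p : ℕ) [Fact p.Prime] (ι : Type*) [Finite ι] :
    IsOpen {f : ι → PadicInt p | ∃ g : ι → PadicInt p, f = (p : PadicInt p) • g} := by
  have h : {f : ι → PadicInt p | ∃ g : ι → PadicInt p, f = (p : PadicInt p) • g} =
      ⋂ i, (fun f ↦ f i) ⁻¹' {x | (p : PadicInt p) ∣ x} := by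
    ext f
    simp only [Set.mem_ofPred_eq, Set.mem_iInter, Set.mem_preimage, dvd_def, Classical.skolem,
      funext_iff, Pi.smul_apply, smul_eq_mul]
  rw [h]
  exact isOpen_iInter_of_finite fun i ↦
    (PadicInt.isOpen_setOf_dvd p).preimage (continuous_apply i)

theorem exists_universal_norm_not_div_by_p (p : ℕ) [Fact p.Prime]
    {S : Type*} [AddCommGroup S] [Module (PadicInt p) S]
    [Module.Free (PadicInt p) S] [Module.Finite (PadicInt p) S]
    (N : ℕ → Submodule (PadicInt p) S)
    (hdec : ∀ m, N (m + 1) ≤ N m)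
    (hv : ∀ m, ∃ v ∈ N m, ¬ ∃ s : S, v = (p : PadicInt p) • s) :
    ∃ v, (∀ m, v ∈ N m) ∧ ¬ ∃ s : S, v = (p : PadicInt p) • s := by
  let ι := Module.Free.ChooseBasisIndex (PadicInt p) S
  let e : S ≃ₗ[PadicInt p] (ι → PadicInt p) :=
    (Module.Free.chooseBasis (PadicInt p) S).equivFun
  let U : Set (ι → PadicInt p) := {f | ∃ g : ι → PadicInt p, f = (p : PadicInt p) • g}
  have hU (s : S) : e s ∈ U ↔ ∃ t : S, s = (p : PadicInt p) • t := by
    simp only [U, Set.mem_ofPred_eq, e.surjective.exists, ← map_smul, e.injective.eq_iff]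
  let t (m : ℕ) : Set (ι → PadicInt p) := (N m).map (e : S →ₗ[PadicInt p] ι → PadicInt p) ∩ Uᶜ
  have ht_closed (m : ℕ) : IsClosed (t m) :=
    (Submodule.isCompact_of_fg (IsNoetherian.noetherian _)).isClosed.inter
      (PadicInt.isOpen_setOf_exists_eq_smul p ι).isClosed_compl
  obtain ⟨f, hf⟩ := IsCompact.nonempty_iInter_of_sequence_nonempty_isCompact_isClosed t
    (fun m ↦ Set.inter_subset_inter_left _ (Submodule.map_mono (hdec m)))
    (fun m ↦ by
      obtain ⟨v, hvN, hvp⟩ := hv m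
      exact ⟨e v, Submodule.mem_map_of_mem hvN, (hU v).not.mpr hvp⟩)
    (ht_closed 0).isCompact ht_closed
  rw [Set.mem_iInter] at hf
  obtain ⟨v, rfl⟩ := e.surjective f
  refine ⟨v, fun m ↦ ?_, (hU v).not.mp (hf 0).2⟩
  obtain ⟨w, hw, hwv⟩ := (hf m).1
  exact e.injective hwv ▸ hw
end
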